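/- arXiv:1204.1514 — 9 statements merged into one kernel-verified Lean document; each statement's English description precedes it below -/
import Mathlib

section
/- Let d : ℕ → ℕ satisfy d i ≥ 2 for all i, let V be the vertex set of the spherically homogeneous rooted tree with branching sequence d, and let G be a group acting on V by rooted-tree automorphisms. If for every vertex v ∈ V the subtree stabilizer is trivial (that is, any g ∈ G with g • w = w for all w with v ≼ w must equal 1), then for every finite subset F ⊆ G with 1 ∉ F there exists a vertex v ∈ V such that g • v ≠ v for every g ∈ F. -/
/-- Vertex set of the spherically homogeneous rooted tree with branching sequence `d`:
a vertex of level `n` is a word `x : Π i : Fin n, Fin (d i)`. -/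
def TreeVertex (d : ℕ → ℕ) : Type := Σ n : ℕ, (∀ i : Fin n, Fin (d i))

/-- `IsAncestor v w` : the vertex `v` is an ancestor of `w` (i.e. `w` belongs to the
subtree rooted at `v`). -/
def IsAncestor {d : ℕ → ℕ} (v w : TreeVertex d) : Prop :=
  ∃ h : v.1 ≤ w.1, ∀ i : Fin v.1, v.2 i = w.2 (Fin.castLE h i)

/-- Two ancestors of a common vertex that lie on the same level coincide. -/
theorem IsAncestor.eq_of_level_eq {d : ℕ → ℕ} {u v w : TreeVertex d}
    (hu : IsAncestor u w) (hv : IsAncestor v w) (h : u.1 = v.1) : u = v := by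
  obtain ⟨m, x⟩ := u
  obtain ⟨n, y⟩ := v
  obtain rfl : m = n := h
  obtain ⟨_, hx⟩ := hu
  obtain ⟨_, hy⟩ := hv
  exact congrArg (Sigma.mk m) (funext fun i => (hx i).trans (hy i).symm)

/-- If all subtree stabilizers are trivial, then the action is locally somewhere free:
for every finite `F ⊆ G` with `1 ∉ F` there is a vertex moved by every element of `F`. -/
theorem trivial_subtree_stabilizers_imp_lsf (d : ℕ → ℕ) (hd : ∀ i, 2 ≤ d i)
    (G : Type*) [Group G] [MulAction G (TreeVertex d)]
    (hlevel : ∀ (g : G) (v : TreeVertex d), (g • v).1 = v.1)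
    (hanc : ∀ (g : G) (v w : TreeVertex d), IsAncestor v w → IsAncestor (g • v) (g • w))
    (htriv : ∀ v : TreeVertex d, ∀ g : G, (∀ w, IsAncestor v w → g • w = w) → g = 1)
    (F : Finset G) (hF : (1 : G) ∉ F) :
    ∃ v : TreeVertex d, ∀ g ∈ F, g • v ≠ v := by
  classical
  induction F using Finset.induction_on with
  | empty => exact ⟨⟨0, fun i => i.elim0⟩, by simp⟩
  | insert g F _ ih =>
    obtain ⟨v, hv⟩ := ih fun h => hF (Finset.mem_insert_of_mem h)
    have hg : g ≠ 1 := by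
      rintro rfl
      exact hF (Finset.mem_insert_self _ _)
    obtain ⟨w, hvw, hw⟩ : ∃ w, IsAncestor v w ∧ g • w ≠ w := by
      by_contra! h
      exact hg (htriv v g h)
    refine ⟨w, fun k hk hkw => ?_⟩
    rcases Finset.mem_insert.mp hk with rfl | hk
    · exact hw hkw
    · have hkv := hanc k v w hvw
      rw [hkw] at hkv
      exact hv k hk (hkv.eq_of_level_eq hvw (hlevel k v))
end

section
/- Fix an integer k ≥ 2 and let V be the vertex set of the k-regular rooted tree (the spherically homogeneous rooted tree with constant branching sequence d i = k). Let G be a group acting faithfully and spherically transitively on V by rooted-tree automorphisms, and assume G is weakly branched: for every vertex v there exists g ∈ G with g ≠ 1 such that g • w = w for every vertex w not belonging to the subtree vT. Then for every integer n ≥ 1 there exists a nonzero element M of MonoidAlgebra ℂ G such that, for the diagonal action of G on n-tuples Fin n → V, M acts as zero on (Fin n → V) →₀ ℂ (that is, M • δ_z = 0 for every z : Fin n → V). In particular, the ℂ-algebra homomorphism from MonoidAlgebra ℂ G to Module.End ℂ ((Fin n → V) →₀ ℂ) induced by the diagonal action is not injective. -/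
open MonoidAlgebra in
/-- If the group elements `g i` move nontrivially, and only inside, pairwise disjoint sets `U i`,
then for every finite `s` some nonzero element of the group algebra, supported on elements fixing
everything outside `⋃ i ∈ s, U i`, kills all tuples missing one of the `U i`, `i ∈ s`. -/
theorem exists_ne_zero_asAlgebraHom_single_eq_zero {R G X ι κ : Type*} [CommRing R] [Nontrivial R]
    [Group G] [MulAction G X] (hfaith : ∀ g : G, (∀ x : X, g • x = x) → g = 1)
    (U : ι → Set X) (hU : Pairwise (Function.onFun Disjoint U))
    (g : ι → G) (hg : ∀ i, g i ≠ 1) (hfix : ∀ i, ∀ x ∉ U i, g i • x = x) (s : Finset ι) :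
    ∃ M : MonoidAlgebra R G, M ≠ 0 ∧
      (∀ h, M.coeff h ≠ 0 → ∀ x, (∀ i ∈ s, x ∉ U i) → h • x = x) ∧
      ∀ z : κ → X, (∃ i ∈ s, ∀ j, z j ∉ U i) →
        (Representation.ofMulAction R G (κ → X)).asAlgebraHom M (single z 1) = 0 := by
  classical
  have hmaps : ∀ i, ∀ x ∈ U i, g i • x ∈ U i := by
    intro i x hx
    by_contra h
    have := MulAction.injective (g i) (hfix i _ h)
    exact h (show g i • x ∈ U i by rwa [show g i • x = x from this])
  induction s using Finset.induction_on with
  | empty =>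
    refine ⟨1, one_ne_zero, fun h hh x _ => ?_, fun z hz => by simp at hz⟩
    have : h = 1 := by
      by_contra hne
      exact hh (by simp [MonoidAlgebra.one_def, Ne.symm hne])
    simp [this]
  | insert a s ha ih =>
    obtain ⟨M, hM0, hMs, hMz⟩ := ih
    have hcoeff : ∀ h, (M * (1 - single (g a) 1)).coeff h =
        M.coeff h - M.coeff (h * (g a)⁻¹) := by
      intro h
      simp [mul_sub]
    refine ⟨M * (1 - single (g a) 1), fun h0 => ?_, fun h hh x hx => ?_,
      fun z hz => ?_⟩
    · obtain ⟨h, hh⟩ : ∃ h, M.coeff h ≠ 0 := by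
        by_contra! hall
        exact hM0 (by ext h; simpa using hall h)
      have hh' : M.coeff (h * (g a)⁻¹) ≠ 0 := by
        have := hcoeff h
        rw [h0] at this
        rwa [← sub_eq_zero.mp this.symm]
      refine hg a (hfaith _ fun x => ?_)
      by_cases hx : x ∈ U a
      · have hxs : ∀ y ∈ U a, ∀ i ∈ s, y ∉ U i := fun y hy i hi hyi =>
          Set.disjoint_left.mp (hU (ne_of_mem_of_not_mem hi ha)) hyi hy
        have h1 := hMs _ hh' _ (hxs _ (hmaps a x hx))
        rw [mul_smul, inv_smul_smul, hMs _ hh _ (hxs x hx)] at h1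
        exact h1.symm
      · exact hfix a x hx
    · have hxa := hfix a x (hx a (Finset.mem_insert_self a s))
      have hxs : ∀ i ∈ s, x ∉ U i := fun i hi => hx i (Finset.mem_insert_of_mem hi)
      by_cases h1 : M.coeff h = 0
      · have h2 : M.coeff (h * (g a)⁻¹) ≠ 0 := by
          intro h2
          exact hh (by rw [hcoeff, h1, h2, sub_zero])
        have h3 := hMs _ h2 x hxs
        rwa [mul_smul, inv_smul_eq_iff.mpr hxa.symm] at h3
      · exact hMs _ h1 x hxs
    · have key : (Representation.ofMulAction R G (κ → X)).asAlgebraHom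
            (M * (1 - single (g a) 1)) (single z 1) =
          (Representation.ofMulAction R G (κ → X)).asAlgebraHom M (single z 1) -
          (Representation.ofMulAction R G (κ → X)).asAlgebraHom M (single (g a • z) 1) := by
        simp [mul_sub, Representation.asAlgebraHom_single, Representation.ofMulAction_single]
      rw [key]
      obtain ⟨i, hi, hzi⟩ := hz
      rcases Finset.mem_insert.mp hi with rfl | hi
      · have : g i • z = z := funext fun j => hfix i _ (hzi j)
        rw [this, sub_self]
      · rw [hMz z ⟨i, hi, hzi⟩, hMz (g a • z) ⟨i, hi, fun j hj => ?_⟩, sub_zero]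
        by_cases hja : z j ∈ U a
        · exact Set.disjoint_left.mp (hU (ne_of_mem_of_not_mem hi ha)) hj (hmaps a _ hja)
        · rw [Pi.smul_apply, hfix a _ hja] at hj
          exact hzi j hj

/-- The vertex `0 ⋯ 0 1` of level `m + 1` in the `k`-regular tree. -/
def combVertex {k : ℕ} (hk : 2 ≤ k) (m : ℕ) : TreeVertex fun _ => k :=
  ⟨m + 1, fun i => if (i : ℕ) = m then ⟨1, by lia⟩ else ⟨0, by lia⟩⟩

theorem pairwise_disjoint_subtree_combVertex {k : ℕ} (hk : 2 ≤ k) :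
    Pairwise (Function.onFun Disjoint fun m => {w | IsAncestor (combVertex hk m) w}) := by
  refine (pairwise_disjoint_on _).mpr fun m m' hlt => Set.disjoint_left.mpr ?_
  rintro w ⟨h, hw⟩ ⟨h', hw'⟩
  have h1 := hw ⟨m, Nat.lt_succ_self m⟩
  have h2 := hw' ⟨m, Nat.lt_succ_of_lt hlt⟩
  have h3 := h1.trans h2.symm
  simp [combVertex, hlt.ne] at h3

/-- Let `G` be a weakly branched group of automorphisms of the `k`-regular rooted tree
(acting faithfully and spherically transitively, with all rigid stabilizers nontrivial).
Then for every `n ≥ 1` some nonzero element of `ℂ[G]` acts as zero on `(Fin n → V) →₀ ℂ`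
for the diagonal action on `n`-tuples of vertices; in particular the induced algebra
homomorphism `ℂ[G] → End ((Fin n → V) →₀ ℂ)` is not injective. -/
theorem weaklyBranched_tensor_power_not_faithful
    (k : ℕ) (hk : 2 ≤ k)
    (G : Type*) [Group G] [MulAction G (TreeVertex fun _ => k)]
    (hlevel : ∀ (g : G) (v : TreeVertex fun _ => k), (g • v).1 = v.1)
    (hanc : ∀ (g : G) (v w : TreeVertex fun _ => k),
      IsAncestor v w → IsAncestor (g • v) (g • w))
    (hfaith : ∀ g : G, (∀ v : TreeVertex fun _ => k, g • v = v) → g = 1)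
    (htrans : ∀ v w : TreeVertex fun _ => k, v.1 = w.1 → ∃ g : G, g • v = w)
    (hwb : ∀ v : TreeVertex fun _ => k, ∃ g : G, g ≠ 1 ∧
      ∀ w : TreeVertex fun _ => k, ¬ IsAncestor v w → g • w = w)
    (n : ℕ) (hn : 1 ≤ n) :
    (∃ M : MonoidAlgebra ℂ G, M ≠ 0 ∧
        (Representation.ofMulAction ℂ G (Fin n → TreeVertex fun _ => k)).asAlgebraHom M
          = 0) ∧
      ¬ Function.Injective
        ⇑((Representation.ofMulAction ℂ G (Fin n → TreeVertex fun _ => k)).asAlgebraHom) := by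
  classical
  choose g hg hfix using fun m => hwb (combVertex hk m)
  have hdisj := pairwise_disjoint_subtree_combVertex hk
  obtain ⟨M, hM0, -, hM⟩ := exists_ne_zero_asAlgebraHom_single_eq_zero (R := ℂ) (κ := Fin n)
    hfaith _ hdisj g hg hfix (Finset.range (n + 1))
  have hzero : (Representation.ofMulAction ℂ G
      (Fin n → TreeVertex fun _ => k)).asAlgebraHom M = 0 := by
    refine MonoidAlgebra.lhom_ext' fun z => LinearMap.ext_ring (hM z ?_)
    by_contra! hall
    have : Nonempty (Fin n) := ⟨⟨0, hn⟩⟩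
    choose! f hf using hall
    obtain ⟨a, -, b, -, hab, hfab⟩ := Finset.exists_ne_map_eq_of_card_lt_of_maps_to
      (s := (Finset.univ : Finset (Fin (n + 1)))) (t := (Finset.univ : Finset (Fin n)))
      (f := fun a => f a) (by simp) (fun _ _ => by simp)
    have ha := hf a (Finset.mem_range.mpr a.2)
    have hb := hf b (Finset.mem_range.mpr b.2)
    rw [hfab] at ha
    exact Set.disjoint_left.mp (hdisj (Fin.val_injective.ne hab)) ha hb
  exact ⟨⟨M, hM0, hzero⟩, fun hinj => hM0 (hinj (hzero.trans (map_zero _).symm))⟩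
end

section
/- Let X be a second-countable metric space equipped with a Borel measure ν, and let G be a group acting on X such that for every g ∈ G the map x ↦ g • x is Borel measurable. Let K ⊆ G be a finite subset, and suppose there is a measurable set F ⊆ X with ν(F) > 0 such that for every γ ∈ K with γ ≠ 1 the set {x ∈ F | γ • x = x} is ν-null. Then there exists a measurable set U ⊆ X with ν(U) > 0 such that for every γ ∈ K with γ ≠ 1 the sets γ • U and U are disjoint (no x ∈ U has γ • x ∈ U). -/
open MeasureTheory

/-- A measurable self-map fixing almost no point of a set `F` of positive measure maps
some subset of `F` of positive measure off itself. -/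
theorem exists_measurableSet_pos_disjoint_image
    {X : Type*} [MeasurableSpace X] [MeasurableSpace.CountablySeparated X] (ν : Measure X)
    {f : X → X} (hf : Measurable f) {F : Set X} (hF : MeasurableSet F) (hpos : 0 < ν F)
    (hfix : ν {x ∈ F | f x = x} = 0) :
    ∃ U ⊆ F, MeasurableSet U ∧ 0 < ν U ∧ ∀ x ∈ U, f x ∉ U := by
  obtain ⟨S, hSc, hSm, hSsep⟩ := MeasurableSpace.CountablySeparated.countably_separated (α := X)
  by_contra! hU
  have hnull : ∀ V : Set X, MeasurableSet V → ν (F ∩ (V \ f ⁻¹' V)) = 0 := by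
    intro V hV
    by_contra hne
    obtain ⟨x, hx, hfx⟩ := hU _ Set.inter_subset_left
      (hF.inter (hV.diff (hf hV))) (pos_iff_ne_zero.2 hne)
    exact hx.2.2 hfx.2.1
  have hcover : F ⊆ {x ∈ F | f x = x} ∪
      ⋃ V ∈ S, (F ∩ (V \ f ⁻¹' V) ∪ F ∩ (Vᶜ \ f ⁻¹' Vᶜ)) := by
    intro x hx
    by_contra hnot
    simp only [Set.mem_union, Set.mem_iUnion, not_or, not_exists] at hnot
    refine hnot.1 ⟨hx, hSsep _ trivial _ trivial fun V hV => ?_⟩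
    have := hnot.2 V hV
    simp only [Set.mem_inter_iff, Set.mem_sdiff, Set.mem_preimage, Set.mem_compl_iff] at this
    tauto
  refine hpos.ne' (measure_mono_null hcover (measure_union_null hfix ?_))
  exact (measure_biUnion_null_iff hSc).2 fun V hV =>
    measure_union_null (hnull V (hSm V hV)) (hnull Vᶜ (hSm V hV).compl)

/-- If a finite set `K` of group elements acts on a second-countable metric measure
space in such a way that each nontrivial element of `K` fixes almost no point of a set
`F` of positive measure, then there is a set `U` of positive measure which is disjoint
from each of its translates by nontrivial elements of `K`. -/
theorem exists_disjoint_translates_of_ae_free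
    {X : Type*} [MetricSpace X] [SecondCountableTopology X]
    [MeasurableSpace X] [BorelSpace X] (ν : Measure X)
    {G : Type*} [Group G] [MulAction G X]
    (hmeas : ∀ g : G, Measurable fun x : X => g • x)
    (K : Finset G) (F : Set X) (hFmeas : MeasurableSet F) (hFpos : 0 < ν F)
    (hfree : ∀ γ ∈ K, γ ≠ (1 : G) → ν {x ∈ F | γ • x = x} = 0) :
    ∃ U : Set X, MeasurableSet U ∧ 0 < ν U ∧
      ∀ γ ∈ K, γ ≠ (1 : G) → ∀ x ∈ U, γ • x ∉ U := by
  classical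
  suffices ∃ U ⊆ F, MeasurableSet U ∧ 0 < ν U ∧
      ∀ γ ∈ K, γ ≠ (1 : G) → ∀ x ∈ U, γ • x ∉ U by
    obtain ⟨U, -, hU⟩ := this
    exact ⟨U, hU⟩
  induction K using Finset.induction_on with
  | empty => exact ⟨F, subset_rfl, hFmeas, hFpos, by simp⟩
  | insert g K _ ih =>
    obtain ⟨U, hUF, hUm, hUpos, hU⟩ :=
      ih fun γ hγ => hfree γ (Finset.mem_insert_of_mem hγ)
    by_cases hg : g = 1
    · refine ⟨U, hUF, hUm, hUpos, fun γ hγ hγ1 => ?_⟩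
      exact hU γ (Finset.mem_of_mem_insert_of_ne hγ (hg ▸ hγ1)) hγ1
    · obtain ⟨V, hVU, hVm, hVpos, hV⟩ :=
        exists_measurableSet_pos_disjoint_image ν (hmeas g) hUm hUpos
          (measure_mono_null (Set.ofPred_subset_ofPred.2 fun x hx => ⟨hUF hx.1, hx.2⟩)
            (hfree g (Finset.mem_insert_self g K) hg))
      refine ⟨V, hVU.trans hUF, hVm, hVpos, fun γ hγ hγ1 x hx => ?_⟩
      obtain rfl | hγK := Finset.mem_insert.1 hγ
      · exact hV x hx
      · exact fun hγx => hU γ hγK hγ1 x (hVU hx) (hVU hγx)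
end

section
/- Let X be a second-countable metric space equipped with a locally finite Borel measure ν, and let G be a group acting on X such that for every g ∈ G the map x ↦ g • x is a measure-preserving measurable map of (X, ν) to itself. Assume the action is locally somewhere free: for every finite subset K ⊆ G there exists a measurable set F ⊆ X with ν(F) > 0 such that for every γ ∈ K with γ ≠ 1 the set {x ∈ F | γ • x = x} is ν-null. Then for every finite subset K ⊆ G there exists a measurable function f : X → ℂ with ∫ ‖f x‖² dν(x) = 1 such that for every g ∈ K, ∫ f (g⁻¹ • x) · conj (f x) dν(x) = (1 if g = 1, and 0 otherwise). (Thus the matrix coefficients of the regular representation of G at the Dirac function δ₁ are realized exactly by matrix coefficients of the Koopman representation of G on L²(X, ν).) -/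
open MeasureTheory

/-- A measurable set of positive measure on which finitely many measurable maps have almost no
fixed points contains a measurable set of positive finite measure which each of these maps
sends into its complement. -/
theorem exists_measurableSet_finite_measure_forall_notMem_of_fixedPoints_null
    {X ι : Type*} [TopologicalSpace X] [T1Space X] [SecondCountableTopology X]
    [MeasurableSpace X] [OpensMeasurableSpace X] (ν : Measure X) [IsLocallyFiniteMeasure ν]
    (K : Finset ι) (T : ι → X → X) (hT : ∀ i ∈ K, Measurable (T i))
    {F : Set X} (hF : MeasurableSet F) (hF0 : 0 < ν F)
    (hfix : ∀ i ∈ K, ν {x ∈ F | T i x = x} = 0) :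
    ∃ B : Set X, MeasurableSet B ∧ 0 < ν B ∧ ν B < ⊤ ∧ ∀ i ∈ K, ∀ x ∈ B, T i x ∉ B := by
  let 𝓑 := TopologicalSpace.countableBasis X
  have h𝓑 : TopologicalSpace.IsTopologicalBasis 𝓑 :=
    TopologicalSpace.isBasis_countableBasis X
  let A : Set X → Set X := fun U => (U ∩ F) ∩ ⋂ i ∈ K, (T i ⁻¹' U)ᶜ
  by_cases hpos : ∃ U ∈ 𝓑, ν U < ⊤ ∧ 0 < ν (A U)
  · obtain ⟨U, hU, hUfin, hA⟩ := hpos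
    have hUm : MeasurableSet U := (h𝓑.isOpen hU).measurableSet
    refine ⟨A U, (hUm.inter hF).inter (K.measurableSet_biInter fun i hi => (hT i hi hUm).compl),
      hA, (measure_mono fun x hx => hx.1.1).trans_lt hUfin, fun i hi x hx hTx => ?_⟩
    exact Set.mem_iInter₂.1 hx.2 i hi hTx.1.1
  · push Not at hpos
    have hcover : F ⊆ (⋃ U ∈ {U ∈ 𝓑 | ν U < ⊤}, A U) ∪ ⋃ i ∈ K, {x ∈ F | T i x = x} := by
      intro x hx
      by_cases hxfix : ∃ i ∈ K, T i x = x
      · obtain ⟨i, hi, hix⟩ := hxfix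
        exact Or.inr (Set.mem_iUnion₂.2 ⟨i, hi, hx, hix⟩)
      · push Not at hxfix
        obtain ⟨W, hxW, hWo, hW⟩ := ν.exists_isOpen_measure_lt_top x
        have hSfin : ((fun i => T i x) '' (K : Set ι)).Finite := K.finite_toSet.image _
        have hxS : x ∈ W ∩ ((fun i => T i x) '' (K : Set ι))ᶜ := by
          refine ⟨hxW, ?_⟩
          rintro ⟨i, hi, hix⟩
          exact hxfix i hi hix
        obtain ⟨U, hU, hxU, hUsub⟩ :=
          h𝓑.exists_subset_of_mem_open hxS (hWo.inter hSfin.isClosed.isOpen_compl)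
        refine Or.inl (Set.mem_iUnion₂.2 ⟨U, ⟨hU, ?_⟩, ⟨hxU, hx⟩, ?_⟩)
        · exact (measure_mono fun y hy => (hUsub hy).1).trans_lt hW
        · exact Set.mem_iInter₂.2 fun i hi hTi => (hUsub hTi).2 ⟨i, hi, rfl⟩
    have hnull : ν F = 0 := by
      refine measure_mono_null hcover (measure_union_null ?_ ?_)
      · rw [measure_biUnion_null_iff
          ((TopologicalSpace.countable_countableBasis X).mono fun U hU => hU.1)]
        exact fun U hU => nonpos_iff_eq_zero.1 (hpos U hU.1 hU.2)
      · exact (measure_biUnion_null_iff K.countable_toSet).2 hfix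
    exact absurd hnull hF0.ne'

/-- If a group `G` acts by measure-preserving transformations on a second-countable
metric space with a locally finite Borel measure, and the action is locally somewhere
free, then for every finite `K ⊆ G` there is a unit vector `f` of `L²(X, ν)` whose
matrix coefficients on `K` under the Koopman representation coincide with those of the
Dirac function `δ₁` under the regular representation. -/
theorem lsf_matrix_coefficients_of_regular
    {X : Type*} [MetricSpace X] [SecondCountableTopology X]
    [MeasurableSpace X] [BorelSpace X] (ν : Measure X) [IsLocallyFiniteMeasure ν]
    {G : Type*} [Group G] [DecidableEq G] [MulAction G X]
    (hmp : ∀ g : G, MeasurePreserving (fun x : X => g • x) ν ν)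
    (hlsf : ∀ K : Finset G, ∃ F : Set X, MeasurableSet F ∧ 0 < ν F ∧
      ∀ γ ∈ K, γ ≠ (1 : G) → ν {x ∈ F | γ • x = x} = 0)
    (K : Finset G) :
    ∃ f : X → ℂ, Measurable f ∧ (∫ x, ‖f x‖ ^ 2 ∂ν) = 1 ∧
      ∀ g ∈ K, (∫ x, f (g⁻¹ • x) * (starRingEnd ℂ) (f x) ∂ν) =
        if g = 1 then 1 else 0 := by
  obtain ⟨F, hF, hF0, hfix⟩ := hlsf K
  obtain ⟨B, hB, hB0, hBfin, hdisj⟩ :=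
    exists_measurableSet_finite_measure_forall_notMem_of_fixedPoints_null ν (K.erase 1)
      (fun g x => g⁻¹ • x) (fun g _ => (hmp g⁻¹).measurable) hF hF0 (by
        intro g hg
        have h := hfix g (Finset.mem_of_mem_erase hg) (Finset.ne_of_mem_erase hg)
        simpa only [inv_smul_eq_iff, eq_comm (b := g • _)] using h)
  have hBpos : 0 < ν.real B := ENNReal.toReal_pos hB0.ne' hBfin.ne
  let f : X → ℂ := B.indicator fun _ => (((√(ν.real B))⁻¹ : ℝ) : ℂ)
  have hnorm : ∀ x, ‖f x‖ ^ 2 = B.indicator (fun _ => (ν.real B)⁻¹) x := by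
    intro x
    by_cases hx : x ∈ B
    · simp only [f, Set.indicator_of_mem hx, Complex.norm_real, Real.norm_eq_abs, sq_abs, inv_pow,
        Real.sq_sqrt hBpos.le]
    · simp [f, hx]
  have hint : (∫ x, ‖f x‖ ^ 2 ∂ν) = 1 := by
    simp_rw [hnorm]
    rw [integral_indicator_const _ hB, smul_eq_mul, mul_inv_cancel₀ hBpos.ne']
  refine ⟨f, measurable_const.indicator hB, hint, fun g hg => ?_⟩
  split_ifs with h1
  · simp only [h1, inv_one, one_smul, Complex.mul_conj']
    exact_mod_cast congrArg (fun r : ℝ => (r : ℂ)) hint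
  · refine integral_eq_zero_of_ae (Filter.Eventually.of_forall fun x => ?_)
    by_cases hx : x ∈ B
    · have hgx : g⁻¹ • x ∉ B := hdisj g (Finset.mem_erase.2 ⟨h1, hg⟩) x hx
      simp [f, hgx]
    · simp [f, hx]
end

section
/- Let d : ℕ → ℕ satisfy d i ≥ 2 for all i, let V be the vertex set of the spherically homogeneous rooted tree with branching sequence d, and let G be a group acting on V by rooted-tree automorphisms. Fix n, N : ℕ, subsets A₀, …, A_N of the set of level-n vertices whose union is the whole set of level-n vertices, and elements g₀, …, g_N of G such that for each i: g_i fixes every vertex of level n, and g_i fixes every vertex w which has an ancestor in A_i (i.e. for all a ∈ A_i and all w with a ≼ w, g_i • w = w). Then the product ∏_{i=0}^{N} (1 - g_i), taken in MonoidAlgebra ℂ G in increasing order of i, acts as zero on V →₀ ℂ. -/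
/-- A product of endomorphisms preserving a submodule `S`, one of which vanishes on `S`,
vanishes on `S`. -/
theorem list_prod_apply_eq_zero_of_mem {R M : Type*} [Semiring R] [AddCommMonoid M] [Module R M]
    (S : Submodule R M) (L : List (Module.End R M)) (hL : ∀ f ∈ L, ∀ x ∈ S, f x ∈ S)
    {f : Module.End R M} (hf : f ∈ L) (hf0 : ∀ x ∈ S, f x = 0) {x : M} (hx : x ∈ S) :
    L.prod x = 0 := by
  have hprod : ∀ L : List (Module.End R M), (∀ f ∈ L, ∀ x ∈ S, f x ∈ S) → L.prod x ∈ S := by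
    intro L hL
    induction L with
    | nil => simpa using hx
    | cons a L ih =>
      rw [List.prod_cons, Module.End.mul_apply]
      exact hL a (by simp) _ (ih fun f hf => hL f (by simp [hf]))
  induction L with
  | nil => simp at hf
  | cons a L ih =>
    have hL' : ∀ f ∈ L, ∀ x ∈ S, f x ∈ S := fun f hf => hL f (by simp [hf])
    rw [List.prod_cons, Module.End.mul_apply]
    rcases List.mem_cons.1 hf with rfl | hf
    · exact hf0 _ (hprod L hL')
    · rw [ih hL' hf, map_zero]

/-- The ordered product of the `1 - g i` kills the basis vector at a point of a set `T` stable
under every `g i` and fixed pointwise by one of them. -/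
theorem asAlgebraHom_prod_one_sub_single_eq_zero {k G X ι : Type*} [CommRing k] [Group G]
    [MulAction G X] (L : List ι) (g : ι → G) (T : Set X)
    (hT : ∀ i ∈ L, ∀ x ∈ T, g i • x ∈ T) {i : ι} (hi : i ∈ L) (hfix : ∀ x ∈ T, g i • x = x)
    {x : X} (hx : x ∈ T) :
    (Representation.ofMulAction k G X).asAlgebraHom
      ((L.map fun i => (1 : MonoidAlgebra k G) - MonoidAlgebra.single (g i) 1).prod)
      (MonoidAlgebra.single x 1) = 0 := by
  have hsingle : ∀ j, (Representation.ofMulAction k G X).asAlgebraHom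
      ((1 : MonoidAlgebra k G) - MonoidAlgebra.single (g j) 1) =
        1 - Representation.ofMulAction k G X (g j) := by
    intro j
    rw [map_sub, map_one, Representation.asAlgebraHom_single_one]
  rw [map_list_prod, List.map_map]
  refine list_prod_apply_eq_zero_of_mem
    (Submodule.span k ((fun x => MonoidAlgebra.single x 1) '' T)) _ ?_ (List.mem_map_of_mem hi) ?_ (Submodule.subset_span ⟨x, hx, rfl⟩)
  · intro f hf
    obtain ⟨j, hj, rfl⟩ := List.mem_map.1 hf
    intro y hy
    rw [Function.comp_apply, hsingle, LinearMap.sub_apply, Module.End.one_apply]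
    refine Submodule.sub_mem _ hy ?_
    revert y
    change Submodule.span k _ ≤
      (Submodule.span k _).comap (Representation.ofMulAction k G X (g j))
    rw [Submodule.span_le]
    rintro _ ⟨z, hz, rfl⟩
    rw [SetLike.mem_coe, Submodule.mem_comap, Representation.ofMulAction_single]
    exact Submodule.subset_span ⟨g j • z, hT j hj z hz, rfl⟩
  · rw [Function.comp_apply, hsingle]
    change Submodule.span k _ ≤ LinearMap.ker _
    rw [Submodule.span_le]
    rintro _ ⟨z, hz, rfl⟩
    rw [SetLike.mem_coe, LinearMap.mem_ker, LinearMap.sub_apply, Module.End.one_apply,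
      Representation.ofMulAction_single, hfix z hz, sub_self]

/-- Every vertex of level at least `n` has an ancestor of level `n`. -/
theorem exists_isAncestor_level_eq {d : ℕ → ℕ} (w : TreeVertex d) {n : ℕ} (h : n ≤ w.1) :
    ∃ v : TreeVertex d, v.1 = n ∧ IsAncestor v w :=
  ⟨⟨n, fun i => w.2 (Fin.castLE h i)⟩, rfl, h, fun _ => rfl⟩

/-- Every vertex of level at most `n` has a descendant of level `n`. -/
theorem exists_isAncestor_of_level_le {d : ℕ → ℕ} (hd : ∀ i, 0 < d i) (w : TreeVertex d) {n : ℕ}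
    (h : w.1 ≤ n) : ∃ v : TreeVertex d, v.1 = n ∧ IsAncestor w v := by
  refine ⟨⟨n, fun i => if hi : (i : ℕ) < w.1 then w.2 ⟨i, hi⟩ else ⟨0, hd i⟩⟩, rfl, h, ?_⟩
  intro i
  simp

/-- If subsets `A 0, …, A N` of the level-`n` vertices cover the whole level, and each
`g i` fixes the level `n` pointwise as well as all subtrees rooted at vertices of `A i`,
then the ordered product `∏ (1 - g i)` in `ℂ[G]` acts as zero on `V →₀ ℂ`. -/
theorem prod_one_sub_acts_as_zero
    (d : ℕ → ℕ) (hd : ∀ i, 2 ≤ d i)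
    (G : Type*) [Group G] [MulAction G (TreeVertex d)]
    (hlevel : ∀ (g : G) (v : TreeVertex d), (g • v).1 = v.1)
    (hanc : ∀ (g : G) (v w : TreeVertex d), IsAncestor v w → IsAncestor (g • v) (g • w))
    (n N : ℕ) (A : Fin (N + 1) → Set (TreeVertex d)) (g : Fin (N + 1) → G)
    (hAlevel : ∀ i, ∀ a ∈ A i, a.1 = n)
    (hAcover : ∀ v : TreeVertex d, v.1 = n → ∃ i, v ∈ A i)
    (hgfixlevel : ∀ i, ∀ v : TreeVertex d, v.1 = n → g i • v = v)
    (hgfixsub : ∀ i, ∀ a ∈ A i, ∀ w, IsAncestor a w → g i • w = w) :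
    (Representation.ofMulAction ℂ G (TreeVertex d)).asAlgebraHom
      (((List.finRange (N + 1)).map fun i =>
        (1 : MonoidAlgebra ℂ G) - MonoidAlgebra.single (g i) 1).prod) = 0 := by
  refine MonoidAlgebra.lhom_ext' fun w => LinearMap.ext_ring ?_
  rw [LinearMap.zero_comp, LinearMap.zero_apply, LinearMap.comp_apply]
  rcases le_total n w.1 with hw | hw
  · obtain ⟨v, hv, hvw⟩ := exists_isAncestor_level_eq w hw
    obtain ⟨i, hi⟩ := hAcover v hv
    refine asAlgebraHom_prod_one_sub_single_eq_zero _ g {u | IsAncestor v u} ?_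
      (List.mem_finRange i) (hgfixsub i v hi) hvw
    intro j _ u hu
    have := hanc (g j) v u hu
    rwa [hgfixlevel j v hv] at this
  · obtain ⟨v, hv, hwv⟩ := exists_isAncestor_of_level_le (fun i => two_pos.trans_le (hd i)) w hw
    have hfix : ∀ j, g j • w = w := by
      intro j
      have := hanc (g j) w v hwv
      rw [hgfixlevel j v hv] at this
      exact this.eq_of_level_eq hwv (hlevel _ _)
    refine asAlgebraHom_prod_one_sub_single_eq_zero _ g {w} ?_ (List.mem_finRange 0) ?_
      (Set.mem_singleton w)
    · rintro j _ _ rfl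
      exact hfix j
    · rintro _ rfl
      exact hfix 0
end

section
/- Let G be a group, N : ℕ, and H₀, …, H_N subgroups of G such that: (a) each H_i is infinite; (b) for all i ≠ j, every element of H_i commutes with every element of H_j; (c) the subgroups are pairwise conjugate in G, i.e. for all i, j there exists α ∈ G with H_j = α H_i α⁻¹. Then there exist elements g₀, …, g_N with g_i ∈ H_i for every i such that the product ∏_{i=0}^{N} (1 - g_i) is nonzero in MonoidAlgebra ℂ G. -/
/-- An infinite set `S` in a group contains some `g` such that `1 - g` does not annihilate a given
nonzero element of the group algebra: otherwise the finite support of that element would contain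
a translate of `S`. -/
theorem MonoidAlgebra.exists_mem_one_sub_single_mul_ne_zero {R G : Type*} [Ring R] [Group G]
    {S : Set G} (hS : S.Infinite) {x : MonoidAlgebra R G} (hx : x ≠ 0) :
    ∃ g ∈ S, ((1 : MonoidAlgebra R G) - MonoidAlgebra.single g 1) * x ≠ 0 := by
  by_contra! h
  obtain ⟨a, ha⟩ : ∃ a, x.coeff a ≠ 0 := by
    by_contra! h0
    exact hx (by ext a; simpa using h0 a)
  refine hS.image (mul_left_injective a).injOn (x.coeff.support.finite_toSet.subset ?_)
  rintro _ ⟨g, hg, rfl⟩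
  have hgx : x = MonoidAlgebra.single g 1 * x := by
    simpa [sub_mul, sub_eq_zero] using h g hg
  have hcoeff : x.coeff (g * a) = x.coeff a := by
    conv_lhs => rw [hgx]
    simp
  simpa [hcoeff] using ha

/-- One can choose elements of finitely many infinite subsets of a group so that the ordered
product of the `1 - g i` is nonzero in the group algebra. -/
theorem MonoidAlgebra.exists_mem_prod_one_sub_single_ne_zero {R G : Type*} [Ring R] [Nontrivial R]
    [Group G] {n : ℕ} (S : Fin n → Set G) (hS : ∀ i, (S i).Infinite) :
    ∃ g : Fin n → G, (∀ i, g i ∈ S i) ∧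
      ((List.finRange n).map fun i =>
        (1 : MonoidAlgebra R G) - MonoidAlgebra.single (g i) 1).prod ≠ 0 := by
  induction n with
  | zero => exact ⟨Fin.elim0, fun i => i.elim0, by simp⟩
  | succ n ih =>
    obtain ⟨g, hg, hprod⟩ := ih (fun i => S i.succ) fun i => hS i.succ
    obtain ⟨g₀, hg₀, hne⟩ := exists_mem_one_sub_single_mul_ne_zero (hS 0) hprod
    refine ⟨Fin.cons g₀ g, Fin.cases hg₀ hg, ?_⟩
    simpa [List.finRange_succ, Function.comp_def] using hne

/-- Given subgroups `H 0, …, H N` of a group `G` which are infinite, elementwise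
commuting for distinct indices, and pairwise conjugate in `G`, one can choose
`g i ∈ H i` so that the ordered product `∏ (1 - g i)` is nonzero in `ℂ[G]`. -/
theorem exists_mem_prod_one_sub_ne_zero
    {G : Type*} [Group G] (N : ℕ) (H : Fin (N + 1) → Subgroup G)
    (hinf : ∀ i, ((H i : Set G)).Infinite)
    (hcomm : ∀ i j, i ≠ j → ∀ x ∈ H i, ∀ y ∈ H j, Commute x y)
    (hconj : ∀ i j, ∃ α : G, (H j : Set G) = (fun x => α * x * α⁻¹) '' (H i : Set G)) :
    ∃ g : Fin (N + 1) → G, (∀ i, g i ∈ H i) ∧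
      (((List.finRange (N + 1)).map fun i =>
        (1 : MonoidAlgebra ℂ G) - MonoidAlgebra.single (g i) 1).prod) ≠ 0 := by
  exact MonoidAlgebra.exists_mem_prod_one_sub_single_ne_zero (fun i => (H i : Set G)) hinf
end

section
/- Let G be a group and g₀, …, g_N elements of G which pairwise commute and satisfy, for every i, g_i ∉ Subgroup.closure {g₀, …, g_{i-1}} (the subgroup generated by the preceding elements; in particular g₀ ≠ 1). Then the product ∏_{i=0}^{N} (1 - g_i) is nonzero in MonoidAlgebra ℂ G. -/
/-- Right multiplication by `1 - g` shifts and subtracts coefficients. -/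
theorem MonoidAlgebra.mul_one_sub_single_apply {k G : Type*} [Ring k] [Group G]
    (f : MonoidAlgebra k G) (g x : G) :
    (f * (1 - MonoidAlgebra.single g 1)).coeff x = f.coeff x - f.coeff (x * g⁻¹) := by
  simp [mul_sub]

/-- The ordered product of the `1 - g i` is supported in the subgroup generated by the `g i`. -/
theorem MonoidAlgebra.mem_closure_of_prod_one_sub_apply_ne_zero {k G : Type*} [Ring k] [Group G]
    (n : ℕ) (g : Fin n → G) (x : G)
    (hx : ((List.finRange n).map fun i =>
      (1 : MonoidAlgebra k G) - MonoidAlgebra.single (g i) 1).prod.coeff x ≠ 0) :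
    x ∈ Subgroup.closure (Set.range g) := by
  induction n generalizing x with
  | zero =>
    have h : x = 1 := by
      by_contra h
      simp [MonoidAlgebra.one_def, Ne.symm h] at hx
    exact h ▸ one_mem _
  | succ n ih =>
    have hle : Subgroup.closure (Set.range fun i : Fin n => g i.castSucc) ≤
        Subgroup.closure (Set.range g) :=
      Subgroup.closure_mono (Set.range_comp_subset_range Fin.castSucc g)
    rw [List.finRange_succ_last, List.map_append, List.prod_append, List.map_map] at hx
    simp only [List.map_singleton, List.prod_singleton, mul_one_sub_single_apply] at hx
    by_cases h : x * (g (Fin.last n))⁻¹ ∈ Subgroup.closure (Set.range g)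
    · simpa using mul_mem h (Subgroup.subset_closure (Set.mem_range_self (Fin.last n)))
    · refine hle (ih (fun i => g i.castSucc) x fun h0 => hx ?_)
      have h1 := not_imp_comm.1 (ih (fun i => g i.castSucc) (x * (g (Fin.last n))⁻¹))
        fun hm => h (hle hm)
      exact (congrArg₂ (· - ·) h0 h1).trans (sub_zero 0)

/-- If each `g i` lies outside the subgroup generated by the preceding elements, then the ordered
product of the `1 - g i` is nonzero; no commutativity is needed. -/
theorem MonoidAlgebra.prod_one_sub_ne_zero {k G : Type*} [Ring k] [Nontrivial k] [Group G]
    (n : ℕ) (g : Fin n → G)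
    (hg : ∀ i : Fin n, g i ∉ Subgroup.closure (g '' {j | j < i})) :
    ((List.finRange n).map fun i =>
      (1 : MonoidAlgebra k G) - MonoidAlgebra.single (g i) 1).prod ≠ 0 := by
  induction n with
  | zero => simp
  | succ n ih =>
    have hrange : Set.range (fun i : Fin n => g i.castSucc) = g '' {j | j < Fin.last n} := by
      ext y
      constructor
      · rintro ⟨i, rfl⟩
        exact ⟨i.castSucc, i.castSucc_lt_last, rfl⟩
      · rintro ⟨j, hj, rfl⟩
        exact ⟨j.castPred hj.ne, by simp⟩
    have hinit := ih (fun i => g i.castSucc) fun i hi => hg i.castSucc <| by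
      refine Subgroup.closure_mono ?_ hi
      rintro _ ⟨j, hj, rfl⟩
      exact ⟨j.castSucc, Fin.castSucc_lt_castSucc_iff.2 hj, rfl⟩
    have hsupp := mem_closure_of_prod_one_sub_apply_ne_zero (k := k) n fun i => g i.castSucc
    rw [List.finRange_succ_last, List.map_append, List.prod_append, List.map_map]
    simp only [List.map_singleton, List.prod_singleton, Function.comp_def]
    intro h0
    apply hinit
    ext x
    by_contra hx
    have hxg := congrArg (fun f => f.coeff x) h0
    simp only [mul_one_sub_single_apply] at hxg
    have hmem := hsupp (x * (g (Fin.last n))⁻¹) fun h => hx <| by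
      rw [h, sub_zero] at hxg
      exact hxg
    refine hg (Fin.last n) (hrange ▸ ?_)
    simpa using mul_mem (inv_mem hmem) (hsupp x hx)


/-- If `g 0, …, g N` pairwise commute and each `g i` lies outside the subgroup generated
by the preceding elements (in particular `g 0 ≠ 1`), then the ordered product
`∏ (1 - g i)` is nonzero in `ℂ[G]`. -/
theorem prod_one_sub_ne_zero_of_not_mem_closure
    {G : Type*} [Group G] (N : ℕ) (g : Fin (N + 1) → G)
    (hcomm : ∀ i j, Commute (g i) (g j))
    (hnotmem : ∀ i : Fin (N + 1), g i ∉ Subgroup.closure (g '' {j | j < i})) :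
    (((List.finRange (N + 1)).map fun i =>
      (1 : MonoidAlgebra ℂ G) - MonoidAlgebra.single (g i) 1).prod) ≠ 0 := by
  exact MonoidAlgebra.prod_one_sub_ne_zero (N + 1) g hnotmem
end

section
/- Let G be a group and g₀, …, g_N pairwise commuting elements of G, each of infinite order. Then there exists an integer m ≥ 1 such that the product ∏_{i=0}^{N} (1 - g_i^m) is nonzero in MonoidAlgebra ℂ G. -/
/-- In the group algebra of a finitely generated abelian group over a domain, a product of
elements `1 - g` with each `g` of infinite order is nonzero. -/
theorem MonoidAlgebra.list_prod_one_sub_single_ne_zero {R A ι : Type*} [Ring R] [IsDomain R]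
    [CommGroup A] [Group.FG A] (l : List ι) (g : ι → A) (hg : ∀ i, ¬ IsOfFinOrder (g i)) :
    (l.map fun i => (1 : MonoidAlgebra R A) - MonoidAlgebra.single (g i) 1).prod ≠ 0 := by
  have : Monoid.FG (A ⧸ CommGroup.torsion A) := Group.fg_iff_monoid_fg.mp inferInstance
  intro h
  have h' := congrArg
    (MonoidAlgebra.mapDomainRingHom R (QuotientGroup.mk' (CommGroup.torsion A))) h
  rw [map_zero, map_list_prod, List.map_map, List.prod_eq_zero_iff, List.mem_map] at h'
  obtain ⟨i, -, hi⟩ := h'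
  simp only [Function.comp_apply, map_sub, map_one, MonoidAlgebra.mapDomainRingHom_apply,
    MonoidAlgebra.mapDomain_single, sub_eq_zero, MonoidAlgebra.one_def] at hi
  have hgi := MonoidAlgebra.single_left_injective one_ne_zero hi
  exact hg i ((QuotientGroup.eq_one_iff (g i)).mp hgi.symm)

/-- If `g 0, …, g N` pairwise commute and each has infinite order, then for some `m ≥ 1`
the ordered product `∏ (1 - g i ^ m)` is nonzero in `ℂ[G]`. -/
theorem exists_pow_prod_one_sub_ne_zero
    {G : Type*} [Group G] (N : ℕ) (g : Fin (N + 1) → G)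
    (hcomm : ∀ i j, Commute (g i) (g j))
    (hord : ∀ i, ¬ IsOfFinOrder (g i)) :
    ∃ m : ℕ, 1 ≤ m ∧
      (((List.finRange (N + 1)).map fun i =>
        (1 : MonoidAlgebra ℂ G) - MonoidAlgebra.single (g i ^ m) 1).prod) ≠ 0 := by
  refine ⟨1, le_rfl, ?_⟩
  let H := Subgroup.closure (Set.range g)
  have : IsMulCommutative H := Subgroup.isMulCommutative_closure (by
    rintro _ ⟨i, rfl⟩ _ ⟨j, rfl⟩
    exact hcomm i j)
  let : CommGroup H := { (inferInstance : Group H) with mul_comm := mul_comm' }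
  have : Group.FG H := Group.closure_finite_fg (Set.range g)
  let g' : Fin (N + 1) → H := fun i => ⟨g i, Subgroup.subset_closure ⟨i, rfl⟩⟩
  have hg' : ∀ i, ¬ IsOfFinOrder (g' i) := fun i hi => hord i (H.subtype.isOfFinOrder hi)
  have hne := MonoidAlgebra.list_prod_one_sub_single_ne_zero (R := ℂ)
    (List.finRange (N + 1)) g' hg'
  have hinj : Function.Injective (MonoidAlgebra.mapDomainRingHom ℂ H.subtype) :=
    MonoidAlgebra.mapDomain_injective H.subtype_injective
  have hmap := (map_ne_zero_iff _ hinj).mpr hne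
  rw [map_list_prod, List.map_map] at hmap
  simp only [Function.comp_def, map_sub, map_one, MonoidAlgebra.mapDomainRingHom_apply,
    MonoidAlgebra.mapDomain_single] at hmap
  simp only [pow_one]
  exact hmap
end

section
/- Let G be a group acting faithfully on a set X, and let g₀, …, g_N be elements of G, each different from 1, whose supports {x ∈ X | g_i • x ≠ x} are pairwise disjoint. Then the product ∏_{i=0}^{N} (1 - g_i) is nonzero in MonoidAlgebra ℂ G. -/
namespace MonoidAlgebra

variable {k G : Type*} [Ring k] [Group G]

theorem one_sub_single_mul_apply (g : G) (p : MonoidAlgebra k G) (h : G) :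
    (((1 : MonoidAlgebra k G) - single g 1) * p).coeff h = p.coeff h - p.coeff (g⁻¹ * h) := by
  simp [sub_mul]

/-- An element in the support of `∏ (1 - g)`, `g ∈ L`, fixes every common fixed point of `L`. -/
theorem smul_eq_of_coeff_prod_one_sub_ne_zero {X : Type*} [MulAction G X] {x : X} {L : List G}
    (hL : ∀ g ∈ L, g • x = x) {h : G}
    (hh : (L.map fun g => (1 : MonoidAlgebra k G) - single g 1).prod.coeff h ≠ 0) :
    h • x = x := by
  induction L generalizing h with
  | nil =>
    by_contra hx
    have h1 : h ≠ 1 := by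
      rintro rfl
      simp at hx
    simp [one_def, h1] at hh
  | cons g L ih =>
    rw [List.forall_mem_cons] at hL
    rw [List.map_cons, List.prod_cons, one_sub_single_mul_apply] at hh
    by_cases hp : (L.map fun g => (1 : MonoidAlgebra k G) - single g 1).prod.coeff h = 0
    · have := ih hL.2 (h := g⁻¹ * h) fun h0 => hh (by rw [hp, h0, sub_zero])
      rw [mul_smul, inv_smul_eq_iff, hL.1] at this
      exact this
    · exact ih hL.2 hp

theorem coeff_one_prod_one_sub {X : Type*} [MulAction G X] {L : List G}
    (hne : ∀ g ∈ L, ∃ x : X, g • x ≠ x)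
    (hdisj : L.Pairwise fun a b => Disjoint {x : X | a • x ≠ x} {x : X | b • x ≠ x}) :
    (L.map fun g => (1 : MonoidAlgebra k G) - single g 1).prod.coeff 1 = 1 := by
  induction L with
  | nil => simp [one_def]
  | cons g L ih =>
    rw [List.forall_mem_cons] at hne
    rw [List.pairwise_cons] at hdisj
    obtain ⟨x, hx⟩ := hne.1
    rw [List.map_cons, List.prod_cons, one_sub_single_mul_apply, ih hne.2 hdisj.2, mul_one,
      sub_eq_self]
    by_contra h0
    have hfix : ∀ b ∈ L, b • x = x := fun b hb => by
      by_contra hbx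
      exact Set.disjoint_left.mp (hdisj.1 b hb) hx hbx
    have := smul_eq_of_coeff_prod_one_sub_ne_zero hfix h0
    exact hx (inv_smul_eq_iff.mp this).symm

end MonoidAlgebra

/-- If a group `G` acts faithfully on a set `X` and `g 0, …, g N` are nontrivial
elements with pairwise disjoint supports, then the ordered product `∏ (1 - g i)` is
nonzero in `ℂ[G]`. -/
theorem prod_one_sub_ne_zero_of_disjoint_supports
    {G : Type*} [Group G] {X : Type*} [MulAction G X]
    (hfaith : ∀ h : G, (∀ x : X, h • x = x) → h = 1)
    (N : ℕ) (g : Fin (N + 1) → G) (hne : ∀ i, g i ≠ 1)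
    (hdisj : ∀ i j, i ≠ j →
      Disjoint {x : X | g i • x ≠ x} {x : X | g j • x ≠ x}) :
    (((List.finRange (N + 1)).map fun i =>
      (1 : MonoidAlgebra ℂ G) - MonoidAlgebra.single (g i) 1).prod) ≠ 0 := by
  have hmoves : ∀ h ∈ (List.finRange (N + 1)).map g, ∃ x : X, h • x ≠ x := by
    intro h hh
    obtain ⟨i, -, rfl⟩ := List.mem_map.mp hh
    by_contra! hfix
    exact hne i (hfaith _ hfix)
  have hpair : ((List.finRange (N + 1)).map g).Pairwise
      fun a b => Disjoint {x : X | a • x ≠ x} {x : X | b • x ≠ x} :=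
    List.pairwise_map.mpr ((List.nodup_finRange _).imp fun hij => hdisj _ _ hij)
  have hone := MonoidAlgebra.coeff_one_prod_one_sub (k := ℂ) hmoves hpair
  rw [List.map_map] at hone
  intro h0
  change (((List.finRange (N + 1)).map fun i =>
    (1 : MonoidAlgebra ℂ G) - MonoidAlgebra.single (g i) 1).prod).coeff 1 = 1 at hone
  simp [h0] at hone
end
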